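/- Let (X,d) be a complete metric space with |X| ≥ n ≥ 2, and let T : X → X be continuous and asymptotically regular. Suppose there exists λ ∈ [0,∞) such that S(Tx₁,…,Txₙ) ≤ λ·Σᵢ₌₁ⁿ d(xᵢ,Txᵢ) for all pairwise distinct points x₁,…,xₙ ∈ X. Then T has a fixed point in X, and T has at most n−1 fixed points. -/

import Mathlib

open Finset Filter Topology

/-- The sum of all pairwise distances between the points `x 0, …, x (n-1)`. -/
noncomputable def pairSum {X : Type*} [MetricSpace X] {n : ℕ} (x : Fin n → X) : ℝ :=
  ∑ i : Fin n, ∑ j ∈ Finset.Ioi i, dist (x i) (x j)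

theorem dist_le_pairSum {X : Type*} [MetricSpace X] {n : ℕ} (x : Fin n → X) {i j : Fin n}
    (hij : i < j) : dist (x i) (x j) ≤ pairSum x :=
  (Finset.single_le_sum (f := fun j => dist (x i) (x j)) (fun _ _ => dist_nonneg)
    (Finset.mem_Ioi.2 hij)).trans
  (Finset.single_le_sum (f := fun i => ∑ j ∈ Finset.Ioi i, dist (x i) (x j))
    (fun _ _ => Finset.sum_nonneg fun _ _ => dist_nonneg) (Finset.mem_univ i))

/-- A periodic point of an asymptotically regular map is a fixed point. -/
theorem Function.IsPeriodicPt.eq_of_tendsto_dist_iterate {X : Type*} [MetricSpace X] {T : X → X}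
    {y : X} {p : ℕ} (hy : Function.IsPeriodicPt T p y) (hp : 0 < p)
    (har : Tendsto (fun m => dist (T^[m] y) (T^[m + 1] y)) atTop (𝓝 0)) : T y = y := by
  have hsub : Tendsto (fun k : ℕ => p * k) atTop atTop := tendsto_id.const_mul_atTop' hp
  have hconst : (fun m => dist (T^[m] y) (T^[m + 1] y)) ∘ (fun k : ℕ => p * k)
      = fun _ => dist y (T y) := by
    funext k
    have hk : T^[p * k] y = y := hy.mul_const k
    simp only [Function.comp_apply, Function.iterate_succ_apply', hk]
  have h := har.comp hsub
  rw [hconst] at h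
  exact (dist_eq_zero.1 (tendsto_nhds_unique tendsto_const_nhds h)).symm

/-- If the images of any `n ≥ 2` distinct points satisfy the Kannan-type bound, then an injective
asymptotically regular orbit is a Cauchy sequence. -/
theorem cauchySeq_iterate_of_pairSum_le {X : Type*} [MetricSpace X] {n : ℕ} (hn : 2 ≤ n)
    {T : X → X} {lam : ℝ} (hlam0 : 0 ≤ lam)
    (hK : ∀ x : Fin n → X, Function.Injective x →
      pairSum (fun i => T (x i)) ≤ lam * ∑ i : Fin n, dist (x i) (T (x i)))
    {x : X} (hinj : Function.Injective fun m => T^[m] x)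
    (har : Tendsto (fun m => dist (T^[m] x) (T^[m + 1] x)) atTop (𝓝 0)) :
    CauchySeq fun m => T^[m] x := by
  refine Metric.cauchySeq_iff'.2 fun ε hε => ?_
  have hc : 0 < lam * n + 1 := by positivity
  obtain ⟨N, hN⟩ := eventually_atTop.1 (har.eventually_lt_const (div_pos hε hc))
  refine ⟨N + 1, fun k hk => ?_⟩
  obtain rfl | hk := hk.eq_or_lt
  · simpa using hε
  obtain ⟨k, rfl⟩ : ∃ l, k = l + 1 := ⟨k - 1, by omega⟩
  let f : Fin n → ℕ := fun i => if i.val = 0 then N else k + (i.val - 1)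
  have hf : Function.Injective f := by
    intro i j hij
    apply Fin.ext
    simp only [f] at hij
    split_ifs at hij <;> omega
  have hfN (i : Fin n) : N ≤ f i := by
    simp only [f]
    split_ifs <;> omega
  have hle : dist (T^[N + 1] x) (T^[k + 1] x) ≤ pairSum fun i => T (T^[f i] x) := by
    have h := dist_le_pairSum (fun i => T (T^[f i] x))
      (i := ⟨0, by omega⟩) (j := ⟨1, by omega⟩) (by simp)
    simpa [f, Function.iterate_succ_apply'] using h
  have hsum : ∑ i : Fin n, dist (T^[f i] x) (T (T^[f i] x)) ≤ n * (ε / (lam * n + 1)) := by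
    have h := Finset.sum_le_card_nsmul Finset.univ
      (fun i : Fin n => dist (T^[f i] x) (T (T^[f i] x))) (ε / (lam * n + 1))
      fun i _ => by simpa only [Function.iterate_succ_apply'] using (hN (f i) (hfN i)).le
    simpa using h
  calc dist (T^[k + 1] x) (T^[N + 1] x)
      = dist (T^[N + 1] x) (T^[k + 1] x) := dist_comm _ _
    _ ≤ lam * ∑ i : Fin n, dist (T^[f i] x) (T (T^[f i] x)) := hle.trans (hK _ (hinj.comp hf))
    _ ≤ lam * (n * (ε / (lam * n + 1))) := mul_le_mul_of_nonneg_left hsum hlam0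
    _ = lam * n * ε / (lam * n + 1) := by ring
    _ < ε := by
      rw [div_lt_iff₀ hc]
      linarith

/-- A continuous, asymptotically regular `n`-point Kannan-type mapping with any
coefficient `λ ∈ [0, ∞)` on a complete metric space has a fixed point, and has at
most `n−1` fixed points. -/
theorem statement16 {X : Type*} [MetricSpace X] [CompleteSpace X] (n : ℕ) (hn : 2 ≤ n)
    (hcard : ∃ f : Fin n → X, Function.Injective f)
    (T : X → X) (hTc : Continuous T)
    (har : ∀ x : X,
      Filter.Tendsto (fun m => dist (T^[m] x) (T^[m + 1] x)) Filter.atTop (nhds 0))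
    (lam : ℝ) (hlam0 : 0 ≤ lam)
    (hK : ∀ x : Fin n → X, Function.Injective x →
      pairSum (fun i => T (x i)) ≤ lam * ∑ i : Fin n, dist (x i) (T (x i))) :
    (∃ w : X, T w = w) ∧
    ¬∃ w : Fin n → X, Function.Injective w ∧ ∀ i, T (w i) = w i := by
  constructor
  · obtain ⟨g, -⟩ := hcard
    let x := g ⟨0, by omega⟩
    by_cases hinj : Function.Injective fun m => T^[m] x
    · obtain ⟨w, hw⟩ := cauchySeq_tendsto_of_complete
        (cauchySeq_iterate_of_pairSum_le hn hlam0 hK hinj (har x))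
      exact ⟨w, isFixedPt_of_tendsto_iterate hw hTc.continuousAt⟩
    · obtain ⟨a, b, hab, hlt⟩ : ∃ a b, T^[a] x = T^[b] x ∧ a < b := by
        simp only [Function.Injective, not_forall] at hinj
        obtain ⟨a, b, hab, hne⟩ := hinj
        obtain h | h := lt_or_gt_of_ne hne
        · exact ⟨a, b, hab, h⟩
        · exact ⟨b, a, hab.symm, h⟩
      have hper : Function.IsPeriodicPt T (b - a) (T^[a] x) := by
        rw [Function.IsPeriodicPt, Function.IsFixedPt, ← Function.iterate_add_apply,
          Nat.sub_add_cancel hlt.le, hab]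
      exact ⟨_, hper.eq_of_tendsto_dist_iterate (Nat.sub_pos_of_lt hlt) (har _)⟩
  · rintro ⟨w, hw, hfix⟩
    have hle := hK w hw
    simp only [hfix, dist_self, Finset.sum_const_zero, mul_zero] at hle
    have hlt : (⟨0, by omega⟩ : Fin n) < ⟨1, by omega⟩ := by simp
    exact ((dist_pos.2 (hw.ne hlt.ne)).trans_le (dist_le_pairSum w hlt)).not_ge hle
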